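/- In SG_3, with a12 = σ1², a13 = σ2σ1²σ2⁻¹, a23 = σ2², b12 = σ1τ1, b13 = σ2σ1τ1σ2⁻¹, b23 = σ2τ2, conjugation by σ1 acts as follows: σ1⁻¹·a12·σ1 = a12; σ1⁻¹·a13·σ1 = a13·a23·a13⁻¹; σ1⁻¹·a23·σ1 = a13; σ1⁻¹·b12·σ1 = b12; σ1⁻¹·b13·σ1 = a13·b23·a13⁻¹; σ1⁻¹·b23·σ1 = b13. -/

import Mathlib

/-- Defining relations of the singular braid group `SG₃`, as elements of the free
group on four generators `0 ↦ σ₁`, `1 ↦ σ₂`, `2 ↦ τ₁`, `3 ↦ τ₂`. -/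
def sg3Rels : Set (FreeGroup (Fin 4)) :=
  {FreeGroup.of 0 * FreeGroup.of 2 * (FreeGroup.of 2 * FreeGroup.of 0)⁻¹,
   FreeGroup.of 1 * FreeGroup.of 3 * (FreeGroup.of 3 * FreeGroup.of 1)⁻¹,
   FreeGroup.of 0 * FreeGroup.of 1 * FreeGroup.of 0 *
     (FreeGroup.of 1 * FreeGroup.of 0 * FreeGroup.of 1)⁻¹,
   FreeGroup.of 0 * FreeGroup.of 1 * FreeGroup.of 2 *
     (FreeGroup.of 3 * FreeGroup.of 0 * FreeGroup.of 1)⁻¹,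
   FreeGroup.of 1 * FreeGroup.of 0 * FreeGroup.of 3 *
     (FreeGroup.of 2 * FreeGroup.of 1 * FreeGroup.of 0)⁻¹}

/-- The singular braid group on 3 strands. -/
abbrev SG3 : Type := PresentedGroup sg3Rels

def σ1 : SG3 := PresentedGroup.of 0
def σ2 : SG3 := PresentedGroup.of 1
def τ1 : SG3 := PresentedGroup.of 2
def τ2 : SG3 := PresentedGroup.of 3

def a12 : SG3 := σ1 ^ 2
def a13 : SG3 := σ2 * σ1 ^ 2 * σ2⁻¹
def a23 : SG3 := σ2 ^ 2
def b12 : SG3 := σ1 * τ1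
def b13 : SG3 := σ2 * σ1 * τ1 * σ2⁻¹
def b23 : SG3 := σ2 * τ2

theorem sg3_rel {u v : FreeGroup (Fin 4)} (h : u * v⁻¹ ∈ sg3Rels) :
    PresentedGroup.mk sg3Rels u = PresentedGroup.mk sg3Rels v :=
  PresentedGroup.mk_eq_mk_of_mul_inv_mem h

theorem rel1 : σ1 * τ1 = τ1 * σ1 :=
  sg3_rel (u := FreeGroup.of 0 * FreeGroup.of 2) (v := FreeGroup.of 2 * FreeGroup.of 0)
    (by simp only [sg3Rels, Set.mem_insert_iff, true_or])

theorem rel2 : σ2 * τ2 = τ2 * σ2 :=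
  sg3_rel (u := FreeGroup.of 1 * FreeGroup.of 3) (v := FreeGroup.of 3 * FreeGroup.of 1)
    (by simp only [sg3Rels, Set.mem_insert_iff, true_or, or_true])

theorem rel3 : σ1 * σ2 * σ1 = σ2 * σ1 * σ2 :=
  sg3_rel (u := FreeGroup.of 0 * FreeGroup.of 1 * FreeGroup.of 0)
    (v := FreeGroup.of 1 * FreeGroup.of 0 * FreeGroup.of 1)
    (by simp only [sg3Rels, Set.mem_insert_iff, true_or, or_true])

theorem rel4 : σ1 * σ2 * τ1 = τ2 * σ1 * σ2 :=
  sg3_rel (u := FreeGroup.of 0 * FreeGroup.of 1 * FreeGroup.of 2)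
    (v := FreeGroup.of 3 * FreeGroup.of 0 * FreeGroup.of 1)
    (by simp only [sg3Rels, Set.mem_insert_iff, true_or, or_true])

theorem rel5 : σ2 * σ1 * τ2 = τ1 * σ2 * σ1 :=
  sg3_rel (u := FreeGroup.of 1 * FreeGroup.of 0 * FreeGroup.of 3)
    (v := FreeGroup.of 2 * FreeGroup.of 1 * FreeGroup.of 0)
    (by simp only [sg3Rels, Set.mem_insert_iff, Set.mem_singleton_iff, or_true])

/-- In any group: the twice-iterated conjugation by `s`, given the braid relation. -/
theorem conj_sq {G : Type*} [Group G] {s t b x : G} (h : s * t * s = t * s * t)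
    (hb : s⁻¹ * b * s = x) (h1 : Commute b t) (h2 : Commute b ((s * t * s) * (s * t * s))) :
    s⁻¹ * x * s = (t * s ^ 2 * t⁻¹) * b * (t * s ^ 2 * t⁻¹)⁻¹ := by
  have e : s ^ 2 * (t * s ^ 2 * t⁻¹) = (s * t * s) * (s * t * s) * (t⁻¹ * t⁻¹) := by
    calc s ^ 2 * (t * s ^ 2 * t⁻¹) = s * (s * t * s) * s * t⁻¹ := by simp only [pow_two, mul_assoc, mul_inv_rev, inv_inv,
      inv_mul_cancel_left, mul_inv_cancel_left, inv_mul_cancel, mul_inv_cancel, mul_one, one_mul]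
      _ = s * (t * s * t) * s * t⁻¹ := by rw [h]
      _ = (s * t * s) * (t * s * t) * (t⁻¹ * t⁻¹) := by
        have : t * s = s * t * s * t⁻¹ := by rw [h]; simp only [pow_two, mul_assoc, mul_inv_rev, inv_inv,
      inv_mul_cancel_left, mul_inv_cancel_left, inv_mul_cancel, mul_inv_cancel, mul_one, one_mul]
        calc s * (t * s * t) * s * t⁻¹ = s * t * s * (t * s) * t⁻¹ := by simp only [pow_two, mul_assoc, mul_inv_rev, inv_inv,
      inv_mul_cancel_left, mul_inv_cancel_left, inv_mul_cancel, mul_inv_cancel, mul_one, one_mul]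
          _ = _ := by simp only [pow_two, mul_assoc, mul_inv_rev, inv_inv,
      inv_mul_cancel_left, mul_inv_cancel_left, inv_mul_cancel, mul_inv_cancel, mul_one, one_mul]
      _ = _ := by rw [← h]
  have c : Commute b (s ^ 2 * (t * s ^ 2 * t⁻¹)) := by
    rw [e]; exact h2.mul_right (h1.inv_right.mul_right h1.inv_right)
  subst hb
  rw [eq_mul_inv_iff_mul_eq]
  have c' := c.eq
  calc s⁻¹ * (s⁻¹ * b * s) * s * (t * s ^ 2 * t⁻¹)
      = s⁻¹ * s⁻¹ * (b * (s ^ 2 * (t * s ^ 2 * t⁻¹))) := by simp only [pow_two, mul_assoc, mul_inv_rev, inv_inv,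
      inv_mul_cancel_left, mul_inv_cancel_left, inv_mul_cancel, mul_inv_cancel, mul_one, one_mul]
    _ = s⁻¹ * s⁻¹ * ((s ^ 2 * (t * s ^ 2 * t⁻¹)) * b) := by rw [c']
    _ = _ := by simp only [pow_two, mul_assoc, mul_inv_rev, inv_inv,
      inv_mul_cancel_left, mul_inv_cancel_left, inv_mul_cancel, mul_inv_cancel, mul_one, one_mul]

theorem s_conj : σ1⁻¹ * σ2 * σ1 = σ2 * σ1 * σ2⁻¹ := by
  rw [eq_mul_inv_iff_mul_eq, mul_assoc, mul_assoc, inv_mul_eq_iff_eq_mul]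
  simpa only [mul_assoc] using rel3.symm

theorem t_conj : σ1⁻¹ * τ2 * σ1 = σ2 * τ1 * σ2⁻¹ := by
  rw [eq_mul_inv_iff_mul_eq, mul_assoc, mul_assoc, inv_mul_eq_iff_eq_mul]
  simpa only [mul_assoc] using rel4.symm

theorem a_conj : σ1⁻¹ * a23 * σ1 = a13 := by
  calc σ1⁻¹ * a23 * σ1 = (σ1⁻¹ * σ2 * σ1) * (σ1⁻¹ * σ2 * σ1) := by unfold a23; simp only [pow_two, mul_assoc, mul_inv_rev, inv_inv,
      inv_mul_cancel_left, mul_inv_cancel_left, inv_mul_cancel, mul_inv_cancel, mul_one, one_mul]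
    _ = a13 := by rw [s_conj]; unfold a13; simp only [pow_two, mul_assoc, mul_inv_rev, inv_inv,
      inv_mul_cancel_left, mul_inv_cancel_left, inv_mul_cancel, mul_inv_cancel, mul_one, one_mul]

theorem b_conj : σ1⁻¹ * b23 * σ1 = b13 := by
  calc σ1⁻¹ * b23 * σ1 = (σ1⁻¹ * σ2 * σ1) * (σ1⁻¹ * τ2 * σ1) := by unfold b23; simp only [pow_two, mul_assoc, mul_inv_rev, inv_inv,
      inv_mul_cancel_left, mul_inv_cancel_left, inv_mul_cancel, mul_inv_cancel, mul_one, one_mul]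
    _ = b13 := by rw [s_conj, t_conj]; unfold b13; simp only [pow_two, mul_assoc, mul_inv_rev, inv_inv,
      inv_mul_cancel_left, mul_inv_cancel_left, inv_mul_cancel, mul_inv_cancel, mul_one, one_mul]

theorem sq_comm {G : Type*} [Group G] {D u v : G} (h : D * u = v * D) (k : D * v = u * D) :
    Commute u (D * D) := by
  have : D * D * u = u * (D * D) := by rw [mul_assoc, h, ← mul_assoc, k, mul_assoc]
  exact this.symm

theorem full_sigma : Commute σ2 ((σ1 * σ2 * σ1) * (σ1 * σ2 * σ1)) := by
  apply sq_comm (v := σ1)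
  · calc σ1 * σ2 * σ1 * σ2 = σ1 * (σ2 * σ1 * σ2) := by simp only [pow_two, mul_assoc, mul_inv_rev, inv_inv,
      inv_mul_cancel_left, mul_inv_cancel_left, inv_mul_cancel, mul_inv_cancel, mul_one, one_mul]
      _ = _ := by rw [← rel3]
  · calc σ1 * σ2 * σ1 * σ1 = σ2 * σ1 * σ2 * σ1 := by rw [rel3]
      _ = _ := by simp only [pow_two, mul_assoc, mul_inv_rev, inv_inv,
      inv_mul_cancel_left, mul_inv_cancel_left, inv_mul_cancel, mul_inv_cancel, mul_one, one_mul]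

theorem full_tau : Commute τ2 ((σ1 * σ2 * σ1) * (σ1 * σ2 * σ1)) := by
  apply sq_comm (v := τ1)
  · calc σ1 * σ2 * σ1 * τ2 = σ2 * σ1 * (σ2 * τ2) := by rw [rel3, mul_assoc]
      _ = σ2 * σ1 * τ2 * σ2 := by rw [rel2, ← mul_assoc]
      _ = τ1 * (σ2 * σ1 * σ2) := by rw [rel5]; simp only [pow_two, mul_assoc, mul_inv_rev, inv_inv,
      inv_mul_cancel_left, mul_inv_cancel_left, inv_mul_cancel, mul_inv_cancel, mul_one, one_mul]
      _ = _ := by rw [rel3]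
  · calc σ1 * σ2 * σ1 * τ1 = σ1 * σ2 * τ1 * σ1 := by rw [mul_assoc, rel1, ← mul_assoc]
      _ = _ := by rw [rel4]; simp only [pow_two, mul_assoc, mul_inv_rev, inv_inv,
      inv_mul_cancel_left, mul_inv_cancel_left, inv_mul_cancel, mul_inv_cancel, mul_one, one_mul]

/-- The action (by conjugation) of `σ₁` on the generators of `SP₃`. -/
theorem stmt6 :
    σ1⁻¹ * a12 * σ1 = a12 ∧
    σ1⁻¹ * a13 * σ1 = a13 * a23 * a13⁻¹ ∧
    σ1⁻¹ * a23 * σ1 = a13 ∧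
    σ1⁻¹ * b12 * σ1 = b12 ∧
    σ1⁻¹ * b13 * σ1 = a13 * b23 * a13⁻¹ ∧
    σ1⁻¹ * b23 * σ1 = b13 := by
  have hs : Commute τ2 σ2 := rel2.symm
  have ht : Commute τ1 σ1 := rel1.symm
  refine ⟨?_, ?_, a_conj, ?_, ?_, b_conj⟩
  · unfold a12; simp only [pow_two, mul_assoc, mul_inv_rev, inv_inv,
      inv_mul_cancel_left, mul_inv_cancel_left, inv_mul_cancel, mul_inv_cancel, mul_one, one_mul]
  · exact conj_sq rel3 a_conj ((Commute.refl σ2).pow_left 2) (full_sigma.pow_left 2)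
  · have : b12 * σ1 = σ1 * b12 := ((Commute.refl σ1).mul_left ht).eq
    rw [mul_assoc, this, inv_mul_cancel_left]
  · exact conj_sq rel3 b_conj ((Commute.refl σ2).mul_left hs) (full_sigma.mul_left full_tau)
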